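/- Let D be an n×d real matrix, let U be an n×r matrix and V an m×r matrix, each with orthonormal columns, and let Ω ⊆ {1,…,d}×{1,…,m} be an index set with |Ω| ≤ s_e. Suppose there are constants α_u ≥ 0 and μ ≥ 0 such that every matrix H ∈ ℝ^{d×m} supported on Ω satisfies ‖D H‖_F ≤ √α_u · ‖H‖_F and ‖𝒫_L(D H)‖_F ≤ μ · ‖D H‖_F. Then for any λ ≥ 0 and any matrix S₀ ∈ ℝ^{d×m} supported on Ω, ‖λ · sign(S₀) − 𝒫_Ω(Dᵀ U Vᵀ)‖_F ≤ λ √s_e + √(r α_u) · μ. -/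

import Mathlib

open Matrix BigOperators

/-- Frobenius norm of a real matrix. -/
noncomputable def frob {n m : ℕ} (X : Matrix (Fin n) (Fin m) ℝ) : ℝ :=
  Real.sqrt (∑ i, ∑ j, X i j ^ 2)

/-- The projection operator `𝒫_L(X) = P X + X Q − P X Q`. -/
def PL {n m : ℕ} (P : Matrix (Fin n) (Fin n) ℝ) (Q : Matrix (Fin m) (Fin m) ℝ)
    (X : Matrix (Fin n) (Fin m) ℝ) : Matrix (Fin n) (Fin m) ℝ :=
  P * X + X * Q - P * X * Q

/-- Entry-wise projection onto a finite index set Ω: agrees with `X` on Ω, zero elsewhere. -/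
def projE {d m : ℕ} (Ω : Finset (Fin d × Fin m))
    (X : Matrix (Fin d) (Fin m) ℝ) : Matrix (Fin d) (Fin m) ℝ :=
  fun i j => if (i, j) ∈ Ω then X i j else 0

/-- Entry-wise sign matrix. -/
noncomputable def signMat {d m : ℕ} (S : Matrix (Fin d) (Fin m) ℝ) :
    Matrix (Fin d) (Fin m) ℝ :=
  fun i j => Real.sign (S i j)

theorem frob_sub_le' {n m : ℕ} (X Y : Matrix (Fin n) (Fin m) ℝ) :
    frob (X - Y) ≤ frob X + frob Y := by
  letI : NormedAddCommGroup (Matrix (Fin n) (Fin m) ℝ) := Matrix.frobeniusNormedAddCommGroup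
  have h : ∀ Z : Matrix (Fin n) (Fin m) ℝ, frob Z = ‖Z‖ := by
    intro Z
    rw [Matrix.frobenius_norm_def, frob, Real.sqrt_eq_rpow]
    simp
  rw [h, h, h]
  exact norm_sub_le X Y

theorem frob_sq' {n m : ℕ} (X : Matrix (Fin n) (Fin m) ℝ) :
    frob X ^ 2 = ∑ i, ∑ j, X i j ^ 2 := by
  rw [frob, Real.sq_sqrt]
  positivity

theorem trace_eq' {n m : ℕ} (X Y : Matrix (Fin n) (Fin m) ℝ) :
    (Xᵀ * Y).trace = ∑ i, ∑ j, X i j * Y i j := by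
  simp only [Matrix.trace, Matrix.diag, Matrix.mul_apply, Matrix.transpose_apply]
  exact Finset.sum_comm

theorem trace_le' {n m : ℕ} (X Y : Matrix (Fin n) (Fin m) ℝ) :
    (Xᵀ * Y).trace ≤ frob X * frob Y := by
  rw [trace_eq', frob, frob]
  simp only [← Fintype.sum_prod_type']
  exact Real.sum_mul_le_sqrt_mul_sqrt Finset.univ _ _

theorem stmt2 {n d m r : ℕ} (s_e : ℕ)
    (D : Matrix (Fin n) (Fin d) ℝ)
    (U : Matrix (Fin n) (Fin r) ℝ) (V : Matrix (Fin m) (Fin r) ℝ)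
    (hU : Uᵀ * U = 1) (hV : Vᵀ * V = 1)
    (Ω : Finset (Fin d × Fin m)) (hcard : Ω.card ≤ s_e)
    (αu μ : ℝ) (hαu : 0 ≤ αu) (hμ : 0 ≤ μ)
    (hup : ∀ H : Matrix (Fin d) (Fin m) ℝ, (∀ i j, (i, j) ∉ Ω → H i j = 0) →
      frob (D * H) ≤ Real.sqrt αu * frob H)
    (hinc : ∀ H : Matrix (Fin d) (Fin m) ℝ, (∀ i j, (i, j) ∉ Ω → H i j = 0) →
      frob (PL (U * Uᵀ) (V * Vᵀ) (D * H)) ≤ μ * frob (D * H))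
    (lam : ℝ) (hlam : 0 ≤ lam)
    (S₀ : Matrix (Fin d) (Fin m) ℝ) (hS₀ : ∀ i j, (i, j) ∉ Ω → S₀ i j = 0) :
    frob (lam • signMat S₀ - projE Ω (Dᵀ * U * Vᵀ)) ≤
      lam * Real.sqrt s_e + Real.sqrt (r * αu) * μ := by
  have hUV : frob (U * Vᵀ) = Real.sqrt r := by
    have h : frob (U * Vᵀ) ^ 2 = r := by
      have h1 : ((U * Vᵀ)ᵀ * (U * Vᵀ)).trace = r := by
        rw [Matrix.transpose_mul, Matrix.transpose_transpose, Matrix.mul_assoc,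
          ← Matrix.mul_assoc Uᵀ, hU, Matrix.one_mul, Matrix.trace_mul_comm, hV]
        simp
      rw [frob_sq', ← h1, trace_eq']
      simp only [sq]
    have h0 : 0 ≤ frob (U * Vᵀ) := Real.sqrt_nonneg _
    rw [← h, Real.sqrt_sq h0]
  have hsign : frob (lam • signMat S₀) ≤ lam * Real.sqrt s_e := by
    have h1 : ∑ i, ∑ j, (lam • signMat S₀) i j ^ 2 ≤ lam ^ 2 * s_e := by
      have h2 : ∀ i j, (lam • signMat S₀) i j ^ 2 ≤ if (i, j) ∈ Ω then lam ^ 2 else 0 := by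
        intro i j
        simp only [Matrix.smul_apply, signMat, smul_eq_mul]
        split_ifs with h
        · rcases Real.sign_apply_eq (S₀ i j) with h | h | h <;> rw [h] <;> nlinarith [sq_nonneg lam]
        · rw [hS₀ i j h]; simp
      calc _ ≤ ∑ i, ∑ j, (if (i, j) ∈ Ω then lam ^ 2 else 0) :=
            Finset.sum_le_sum fun i _ => Finset.sum_le_sum fun j _ => h2 i j
        _ = ∑ p : Fin d × Fin m, (if p ∈ Ω then lam ^ 2 else 0) := by
            rw [Fintype.sum_prod_type]
        _ = lam ^ 2 * Ω.card := by simp [mul_comm]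
        _ ≤ _ := by gcongr
    calc _ ≤ Real.sqrt (lam ^ 2 * s_e) := Real.sqrt_le_sqrt h1
      _ = _ := by rw [Real.sqrt_mul (sq_nonneg _), Real.sqrt_sq hlam]
  have hproj : frob (projE Ω (Dᵀ * U * Vᵀ)) ≤ Real.sqrt (r * αu) * μ := by
    set H := projE Ω (Dᵀ * U * Vᵀ) with hH
    have hsupp : ∀ i j, (i, j) ∉ Ω → H i j = 0 := fun i j h => by simp [hH, projE, h]
    have e1 : frob H ^ 2 = (Hᵀ * (Dᵀ * U * Vᵀ)).trace := by
      rw [frob_sq', trace_eq']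
      refine Finset.sum_congr rfl fun i _ => Finset.sum_congr rfl fun j _ => ?_
      simp only [hH, projE]
      split_ifs <;> ring
    have e2 : (PL (U * Uᵀ) (V * Vᵀ) (D * H))ᵀ * (U * Vᵀ) = Hᵀ * (Dᵀ * U * Vᵀ) := by
      have hU' : ∀ Z : Matrix (Fin r) (Fin m) ℝ, Uᵀ * (U * Z) = Z := fun Z => by
        rw [← Matrix.mul_assoc, hU, Matrix.one_mul]
      simp only [PL, Matrix.transpose_sub, Matrix.transpose_add, Matrix.transpose_mul,
        Matrix.transpose_transpose, Matrix.sub_mul, Matrix.add_mul, Matrix.mul_assoc, hU']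
      abel
    have e3 : frob H ^ 2 ≤ (μ * (Real.sqrt αu * frob H)) * Real.sqrt r := by
      rw [e1, ← e2, ← hUV]
      refine (trace_le' _ _).trans ?_
      have := (hinc H hsupp).trans (mul_le_mul_of_nonneg_left (hup H hsupp) hμ)
      exact mul_le_mul_of_nonneg_right this (Real.sqrt_nonneg _)
    rw [Real.sqrt_mul (Nat.cast_nonneg r)]
    have h0 : 0 ≤ frob H := Real.sqrt_nonneg _
    rcases h0.eq_or_lt with h | h
    · rw [← h]; positivity
    · refine le_of_mul_le_mul_right ?_ h
      nlinarith [e3]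
  exact (frob_sub_le' _ _).trans (add_le_add hsign hproj)
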